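/- A linear endomorphism D of C is a derivation of the algebra C (i.e. D(P·Q) = D(P)·Q + P·D(Q) for all P, Q ∈ C) if and only if D(1,0) = 0, D maps the subspace {0} × F⁷ into itself, and the induced endomorphism d of F⁷ satisfies d(X × Y) = d(X) × Y + X × d(Y) for all X, Y ∈ F⁷. Moreover, every derivation D of C satisfies n(D P, Q) + n(P, D Q) = 0 for all P, Q ∈ C, i.e. Der(C) ⊆ so(C, n). -/

import Mathlib

open Matrix

noncomputable section

/-- `F⁷`, identified with `F × F³ × F³`, elements written `(s, u, v)`. -/
abbrev V7 (F : Type) := F × (Fin 3 → F) × (Fin 3 → F)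

variable {F : Type} [Field F]

/-- The quadratic form `n(s,u,v) = -s² - 4 uᵀv` on `F⁷`. -/
def nq (X : V7 F) : F := -X.1 ^ 2 - 4 * (X.2.1 ⬝ᵥ X.2.2)

/-- The symmetric bilinear form associated to `n` by polarization. -/
def nb (X Y : V7 F) : F := (nq (X + Y) - nq X - nq Y) / 2

/-- The bilinear product `×` on `F⁷`. -/
def cr (X Y : V7 F) : V7 F :=
  (2 * (X.2.1 ⬝ᵥ Y.2.2) - 2 * (X.2.2 ⬝ᵥ Y.2.1),
   X.1 • Y.2.1 - Y.1 • X.2.1 - (2 : F) • (crossProduct X.2.2 Y.2.2),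
   -(X.1 • Y.2.2) + Y.1 • X.2.2 + (2 : F) • (crossProduct X.2.1 Y.2.1))

/-- The octonion algebra `C = F × F⁷`. -/
abbrev Oct (F : Type) := F × V7 F

/-- The product on `C`: `(α,X)·(β,Y) = (αβ − n(X,Y), α·Y + β·X + X × Y)`. -/
def omul (P Q : Oct F) : Oct F :=
  (P.1 * Q.1 - nb P.2 Q.2, P.1 • Q.2 + Q.1 • P.2 + cr P.2 Q.2)

/-- The extended bilinear form on `C`: `n((α,X),(β,Y)) = αβ + n(X,Y)`. -/
def onb (P Q : Oct F) : F := P.1 * Q.1 + nb P.2 Q.2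

/-- Statement 6 for a given field `F`. -/
def Stmt6 (F : Type) [Field F] : Prop :=
  (∀ D : Oct F →ₗ[F] Oct F,
    (∀ P Q : Oct F, D (omul P Q) = omul (D P) Q + omul P (D Q)) ↔
      (D ((1, 0) : Oct F) = 0 ∧
       (∀ X : V7 F, (D ((0, X) : Oct F)).1 = 0) ∧
       (∀ X Y : V7 F,
          (D ((0, cr X Y) : Oct F)).2
            = cr (D ((0, X) : Oct F)).2 Y + cr X (D ((0, Y) : Oct F)).2))) ∧
  (∀ D : Oct F →ₗ[F] Oct F,
    (∀ P Q : Oct F, D (omul P Q) = omul (D P) Q + omul P (D Q)) →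
      ∀ P Q : Oct F, onb (D P) Q + onb P (D Q) = 0)

lemma nb_eq (h2 : (2 : F) ≠ 0) (X Y : V7 F) :
    nb X Y = -(X.1 * Y.1) - 2 * (X.2.1 ⬝ᵥ Y.2.2 + X.2.2 ⬝ᵥ Y.2.1) := by
  rw [nb, div_eq_iff h2]
  simp only [nq, Prod.fst_add, Prod.snd_add, add_dotProduct, dotProduct_add,
    dotProduct_comm X.2.2 Y.2.1]
  ring

lemma nb_comm (X Y : V7 F) : nb X Y = nb Y X := by
  rw [nb, nb, add_comm X Y]
  ring

lemma nb_add_left (h2 : (2 : F) ≠ 0) (X Y Z : V7 F) : nb (X + Y) Z = nb X Z + nb Y Z := by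
  simp only [nb_eq h2, Prod.fst_add, Prod.snd_add, add_dotProduct]
  ring

lemma nb_add_right (h2 : (2 : F) ≠ 0) (X Y Z : V7 F) : nb X (Y + Z) = nb X Y + nb X Z := by
  rw [nb_comm, nb_add_left h2, nb_comm Y, nb_comm Z]

lemma cr_anticomm (X Y : V7 F) : cr X Y + cr Y X = 0 := by
  ext i
  · simp [cr, dotProduct_comm]
  · fin_cases i <;> simp [cr, cross_apply] <;> ring
  · fin_cases i <;> simp [cr, cross_apply] <;> ring

lemma cr_self (X : V7 F) : cr X X = 0 := by
  ext i <;> simp [cr, dotProduct_comm]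

/-- The polarized identity `X × (X × Y) = -n(X) Y + n(X, Y) X`. -/
lemma cr_cr_add (h2 : (2 : F) ≠ 0) (A X Y : V7 F) :
    cr A (cr X Y) + cr X (cr A Y) = -((2 * nb A X) • Y) + nb A Y • X + nb X Y • A := by
  simp only [nb_eq h2]
  obtain ⟨a, p, q⟩ := A
  obtain ⟨s, u, v⟩ := X
  obtain ⟨t, x, y⟩ := Y
  ext i
  · simp [cr, cross_apply, dotProduct, Fin.sum_univ_three, vecHead, vecTail]
    ring
  · fin_cases i <;> simp [cr, cross_apply, dotProduct, Fin.sum_univ_three, vecHead, vecTail] <;> ring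
  · fin_cases i <;> simp [cr, cross_apply, dotProduct, Fin.sum_univ_three, vecHead, vecTail] <;> ring

lemma cr_cr_self (h2 : (2 : F) ≠ 0) (X Y : V7 F) :
    cr X (cr X Y) = -(nb X X • Y) + nb X Y • X := by
  have h := cr_cr_add h2 X X Y
  rw [← two_smul F] at h
  apply smul_right_injective _ h2
  dsimp only
  rw [h]
  module

/-- `V7 F` is not spanned by a single vector. -/
lemma eq_zero_of_forall_smul_eq {k : F} {X : V7 F} (h : ∀ Y : V7 F, ∃ m : F, k • Y = m • X) :
    k = 0 := by
  obtain ⟨m, hm⟩ := h (1, 0, 0)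
  obtain ⟨m', hm'⟩ := h (0, Pi.single 0 1, 0)
  have h1 := congrArg Prod.fst hm
  have h2 := congrFun (congrArg (fun Z : V7 F => Z.2.1) hm) 0
  have h4 := congrFun (congrArg (fun Z : V7 F => Z.2.1) hm') 0
  simp only [Prod.smul_fst, Prod.smul_snd, Pi.smul_apply, smul_eq_mul, Pi.zero_apply,
    Pi.single_eq_same, mul_one, mul_zero] at h1 h2 h4
  have : k * k = 0 := by
    linear_combination k * h1 + m * X.1 * h4 - m' * X.1 * h2
  exact mul_self_eq_zero.mp this

lemma nb_skew_of_self (h2 : (2 : F) ≠ 0) (d : V7 F →+ V7 F) (h : ∀ X, nb (d X) X = 0)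
    (X Y : V7 F) : nb (d X) Y + nb X (d Y) = 0 := by
  have := h (X + Y)
  rw [map_add, nb_add_left h2, nb_add_right h2, nb_add_right h2, h, h] at this
  rw [nb_comm X]
  linear_combination this

/-- A derivation of the cross product is skew for the bilinear form. -/
lemma nb_skew_of_cr (h2 : (2 : F) ≠ 0) (d : V7 F →ₗ[F] V7 F)
    (hd : ∀ X Y, d (cr X Y) = cr (d X) Y + cr X (d Y)) (X Y : V7 F) :
    nb (d X) Y + nb X (d Y) = 0 := by
  refine nb_skew_of_self h2 d.toAddMonoidHom (fun X => ?_) X Y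
  change nb (d X) X = 0
  have key : 2 * nb (d X) X = 0 := by
    refine eq_zero_of_forall_smul_eq (X := X) fun Y => ⟨nb (d X) Y + nb X (d Y), ?_⟩
    have h := congrArg d (cr_cr_self h2 X Y)
    have hcr (A B C : V7 F) : cr A (B + C) = cr A B + cr A C := by
      ext i <;> simp [cr, smul_add] <;> ring
    rw [hd, hd, hcr, cr_cr_self h2 X (d Y), ← add_assoc, cr_cr_add h2] at h
    simp only [map_add, map_neg, map_smul] at h
    rw [← sub_eq_zero] at h ⊢
    rw [← neg_eq_zero, ← h]
    module
  exact (mul_eq_zero.mp key).resolve_left h2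

lemma omul_inr (X Y : V7 F) : omul (0, X) (0, Y) = (-nb X Y, cr X Y) := by
  simp [omul]

lemma nb_zero_left (X : V7 F) : nb 0 X = 0 := by simp [nb, nq]

lemma nb_zero_right (X : V7 F) : nb X 0 = 0 := by simp [nb, nq]

lemma cr_zero_left (X : V7 F) : cr 0 X = 0 := by ext <;> simp [cr]

lemma cr_zero_right (X : V7 F) : cr X 0 = 0 := by ext <;> simp [cr]

lemma one_omul (P : Oct F) : omul (1, 0) P = P := by
  simp [omul, nb_zero_left, cr_zero_left]

lemma omul_one (P : Oct F) : omul P (1, 0) = P := by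
  simp [omul, nb_zero_right, cr_zero_right]

section Derivation

variable {D : Oct F →ₗ[F] Oct F}

lemma map_eq_of_map_one (h1 : D (1, 0) = 0) (P : Oct F) : D P = D (0, P.2) := by
  have : P = P.1 • ((1, 0) : Oct F) + (0, P.2) := by ext <;> simp
  conv_lhs => rw [this]
  rw [map_add, map_smul, h1, smul_zero, zero_add]

lemma map_one_of_derivation (h : ∀ P Q, D (omul P Q) = omul (D P) Q + omul P (D Q)) :
    D (1, 0) = 0 := by
  have := h (1, 0) (1, 0)
  rw [one_omul, omul_one, one_omul] at this
  exact left_eq_add.mp this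

lemma omul_inr_map_self (h : ∀ P Q, D (omul P Q) = omul (D P) Q + omul P (D Q)) (X : V7 F) :
    (D (0, X)).1 • X + (D (0, X)).1 • X = 0 ∧ nb (D (0, X)).2 X + nb X (D (0, X)).2 = 0 := by
  have hX := h (0, X) (0, X)
  rw [omul_inr, map_eq_of_map_one (map_one_of_derivation h)] at hX
  simp only [cr_self] at hX
  rw [show ((0, 0) : Oct F) = 0 from rfl, map_zero] at hX
  have hfst := congrArg Prod.fst hX
  have hsnd := congrArg Prod.snd hX
  simp only [omul, Prod.fst_add, Prod.snd_add, Prod.fst_zero, Prod.snd_zero, zero_smul,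
    zero_add, add_zero, mul_zero, zero_mul] at hfst hsnd
  refine ⟨?_, by linear_combination hfst⟩
  rw [add_add_add_comm, cr_anticomm, add_zero] at hsnd
  exact hsnd.symm

lemma map_inr_fst_of_derivation (h2 : (2 : F) ≠ 0)
    (h : ∀ P Q, D (omul P Q) = omul (D P) Q + omul P (D Q)) (X : V7 F) :
    (D (0, X)).1 = 0 := by
  have hX := (omul_inr_map_self h X).1
  rw [← two_smul F, smul_eq_zero_iff_right h2, smul_eq_zero] at hX
  rcases hX with hX | rfl
  · exact hX
  · rw [show ((0, 0) : Oct F) = 0 from rfl, map_zero, Prod.fst_zero]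

variable (D) in
/-- The endomorphism of `V7 F` induced by an endomorphism of `Oct F`. -/
def inducedMap : V7 F →ₗ[F] V7 F :=
  LinearMap.snd F F (V7 F) ∘ₗ D ∘ₗ LinearMap.inr F F (V7 F)

lemma inducedMap_apply (X : V7 F) : inducedMap D X = (D (0, X)).2 := rfl

lemma map_eq_inducedMap (h1 : D (1, 0) = 0) (h0 : ∀ X : V7 F, (D (0, X)).1 = 0) (P : Oct F) :
    D P = (0, inducedMap D P.2) := by
  rw [map_eq_of_map_one h1]
  exact Prod.ext (h0 _) rfl

lemma inducedMap_skew_of_derivation (h2 : (2 : F) ≠ 0)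
    (h : ∀ P Q, D (omul P Q) = omul (D P) Q + omul P (D Q)) (X Y : V7 F) :
    nb (inducedMap D X) Y + nb X (inducedMap D Y) = 0 := by
  refine nb_skew_of_self h2 (inducedMap D).toAddMonoidHom (fun X => ?_) X Y
  have hX := (omul_inr_map_self h X).2
  rw [nb_comm X, ← two_mul] at hX
  exact (mul_eq_zero.mp hX).resolve_left h2

lemma inducedMap_cr_of_derivation (h2 : (2 : F) ≠ 0)
    (h : ∀ P Q, D (omul P Q) = omul (D P) Q + omul P (D Q)) (X Y : V7 F) :
    inducedMap D (cr X Y) = cr (inducedMap D X) Y + cr X (inducedMap D Y) := by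
  have hXY := congrArg Prod.snd (h (0, X) (0, Y))
  simp only [map_eq_inducedMap (map_one_of_derivation h) (map_inr_fst_of_derivation h2 h),
    omul_inr, Prod.snd_add] at hXY
  exact hXY

lemma derivation_of_inducedMap (h2 : (2 : F) ≠ 0) (h1 : D (1, 0) = 0)
    (h0 : ∀ X : V7 F, (D (0, X)).1 = 0)
    (hd : ∀ X Y, inducedMap D (cr X Y) = cr (inducedMap D X) Y + cr X (inducedMap D Y))
    (P Q : Oct F) : D (omul P Q) = omul (D P) Q + omul P (D Q) := by
  simp only [map_eq_inducedMap h1 h0, omul, map_add, map_smul, hd]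
  refine Prod.ext ?_ ?_
  · simp only [Prod.fst_add]
    linear_combination nb_skew_of_cr h2 _ hd P.2 Q.2
  · simp only [Prod.snd_add]
    module

end Derivation

lemma stmt6_of_two_ne_zero (h2 : (2 : F) ≠ 0) : Stmt6 F := by
  refine ⟨fun D => ⟨fun h => ⟨map_one_of_derivation h, map_inr_fst_of_derivation h2 h,
    inducedMap_cr_of_derivation h2 h⟩, fun ⟨h1, h0, hd⟩ => derivation_of_inducedMap h2 h1 h0 hd⟩,
    fun D h P Q => ?_⟩
  simp only [map_eq_inducedMap (map_one_of_derivation h) (map_inr_fst_of_derivation h2 h), onb]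
  linear_combination inducedMap_skew_of_derivation h2 h P.2 Q.2

/-- For `F = ℝ` and `F = ℂ`: a linear endomorphism `D` of `C` is a derivation of `C`
iff `D(1,0) = 0`, `D` maps `{0} × F⁷` into itself, and the induced endomorphism `d`
of `F⁷` satisfies `d(X × Y) = d(X) × Y + X × d(Y)`. Moreover, every derivation `D`
of `C` satisfies `n(DP, Q) + n(P, DQ) = 0` for all `P, Q`, i.e. `Der(C) ⊆ so(C, n)`. -/
theorem stmt6 : Stmt6 ℝ ∧ Stmt6 ℂ := by
  exact ⟨stmt6_of_two_ne_zero two_ne_zero, stmt6_of_two_ne_zero two_ne_zero⟩
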